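/- arXiv:1809.04778 — 3 statements merged into one kernel-verified Lean document; each statement's English description precedes it below -/
import Mathlib

section
/- Let X be an n-dimensional real polyhedral Banach space with vertices ±v₁, …, ±v_m of its unit ball. For each i, let f_{i1}, …, f_{in} be supporting functionals corresponding to n facets of B_X meeting at v_i, and set κ_i = min_{x ∈ S_X} max_{1 ≤ r ≤ n} |f_{ir}(x)|. Then the numerical index of X satisfies n(X) ≥ min{κ₁, …, κ_m}. -/
open Metric Set

/-- The numerical radius of a bounded linear operator. -/
noncomputable def nrad {X : Type*} [NormedAddCommGroup X] [NormedSpace ℝ X]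
    (T : X →L[ℝ] X) : ℝ :=
  sSup {r : ℝ | ∃ x : X, ∃ f : X →L[ℝ] ℝ, ‖x‖ = 1 ∧ ‖f‖ = 1 ∧ f x = 1 ∧ r = |f (T x)|}

/-- The numerical index of a normed space. -/
noncomputable def nindex (X : Type*) [NormedAddCommGroup X] [NormedSpace ℝ X] : ℝ :=
  sInf {r : ℝ | ∃ T : X →L[ℝ] X, ‖T‖ = 1 ∧ r = nrad T}

/-- `F` is a facet ((n-1)-dimensional face) of the closed unit ball of `X`. -/
def IsFacet (X : Type*) [NormedAddCommGroup X] [NormedSpace ℝ X] (F : Set X) : Prop :=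
  ∃ g : X →L[ℝ] ℝ, g ≠ 0 ∧ (∀ x ∈ closedBall (0 : X) 1, g x ≤ 1) ∧
    F = {x ∈ closedBall (0 : X) 1 | g x = 1} ∧
    Module.finrank ℝ (vectorSpan ℝ F) = Module.finrank ℝ X - 1

/-- `f` is a supporting functional corresponding to the facet `F` of the unit ball. -/
def IsSuppFun {X : Type*} [NormedAddCommGroup X] [NormedSpace ℝ X]
    (f : X →L[ℝ] ℝ) (F : Set X) : Prop :=
  ‖f‖ = 1 ∧ ∃ v ∈ F, f v = 1 ∧ F = {x : X | f x = 1} ∩ sphere (0 : X) 1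

theorem stmt_3 {X : Type*} [NormedAddCommGroup X] [NormedSpace ℝ X] [FiniteDimensional ℝ X]
    (hpoly : (Set.extremePoints ℝ (closedBall (0 : X) 1)).Finite)
    (n m : ℕ) (hn : Module.finrank ℝ X = n) (hm : 0 < m)
    (v : Fin m → X)
    (hv : Set.extremePoints ℝ (closedBall (0 : X) 1) = {x : X | ∃ i, x = v i ∨ x = -v i})
    (F : Fin m → Fin n → Set X) (f : Fin m → Fin n → X →L[ℝ] ℝ)
    (hF : ∀ i r, IsFacet X (F i r) ∧ v i ∈ F i r ∧ IsSuppFun (f i r) (F i r))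
    (κ : Fin m → ℝ)
    (hκ : ∀ i, κ i = sInf {t : ℝ | ∃ x : X, ‖x‖ = 1 ∧ t = ⨆ r, |f i r x|}) :
    nindex X ≥ ⨅ i, κ i := by
  rcases subsingleton_or_nontrivial X with hX | hX
  · have h0 : ∀ i, κ i = 0 := by
      intro i
      rw [hκ i]
      have : {t : ℝ | ∃ x : X, ‖x‖ = 1 ∧ t = ⨆ r, |f i r x|} = ∅ := by
        ext t
        simp only [mem_setOf_eq, mem_empty_iff_false, iff_false]
        rintro ⟨x, hx, -⟩
        rw [Subsingleton.elim x 0, norm_zero] at hx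
        exact zero_ne_one hx
      rw [this, Real.sInf_empty]
    have h1 : nindex X = 0 := by
      unfold nindex
      have : {r : ℝ | ∃ T : X →L[ℝ] X, ‖T‖ = 1 ∧ r = nrad T} = ∅ := by
        ext t
        simp only [mem_setOf_eq, mem_empty_iff_false, iff_false]
        rintro ⟨T, hT, -⟩
        rw [Subsingleton.elim T 0, norm_zero] at hT
        exact zero_ne_one hT
      rw [this, Real.sInf_empty]
    rw [h1]
    simp [h0]
  · haveI : ProperSpace X := FiniteDimensional.proper ℝ X
    refine le_csInf ⟨_, ContinuousLinearMap.id ℝ X, ContinuousLinearMap.norm_id, rfl⟩ ?_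
    rintro _ ⟨T, hT, rfl⟩
    -- the numerical range is bounded by one
    have hbdd : BddAbove {r : ℝ | ∃ x : X, ∃ f : X →L[ℝ] ℝ, ‖x‖ = 1 ∧ ‖f‖ = 1 ∧ f x = 1 ∧
        r = |f (T x)|} := by
      refine ⟨1, ?_⟩
      rintro _ ⟨x, f, hx, hf, -, rfl⟩
      have h1 := f.le_opNorm (T x)
      have h2 := T.le_opNorm x
      rw [hf, one_mul, Real.norm_eq_abs] at h1
      rw [hT, hx, one_mul] at h2
      exact h1.trans h2
    have hnn : 0 ≤ nrad T := by
      apply Real.sSup_nonneg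
      rintro _ ⟨x, f, -, -, -, rfl⟩
      exact abs_nonneg _
    -- norm attainment at some vertex
    have hatt : ∃ i, ‖T (v i)‖ = 1 := by
      have hK : IsCompact (closedBall (0 : X) 1) := isCompact_closedBall _ _
      obtain ⟨x0, hx0, hmax⟩ := hK.exists_isMaxOn ⟨0, by simp⟩
        (f := fun x => ‖T x‖) (by fun_prop)
      have hle : ∀ x ∈ closedBall (0 : X) 1, ‖T x‖ ≤ 1 := by
        intro x hx
        have h2 := T.le_opNorm x
        rw [hT, one_mul] at h2
        exact h2.trans (by simpa using hx)
      have hx01 : ‖T x0‖ = 1 := by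
        apply le_antisymm (hle x0 hx0)
        rw [← hT]
        refine T.opNorm_le_of_unit_norm (norm_nonneg _) ?_
        intro x hx
        exact hmax (by simp [hx])
      obtain ⟨g, hg, hgx⟩ := exists_dual_vector ℝ (T x0) (by
        intro h; rw [h] at hx01; exact zero_ne_one hx01)
      have hgx1 : g (T x0) = 1 := by rw [hgx, hx01]; simp
      have hgle : ∀ y, g y ≤ ‖y‖ := fun y => by
        have := g.le_opNorm y
        rw [hg, one_mul, Real.norm_eq_abs] at this
        exact (le_abs_self _).trans this
      let l : X →L[ℝ] ℝ := g.comp T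
      have hexp : IsExposed ℝ (closedBall (0 : X) 1) (l.toExposed (closedBall (0 : X) 1)) :=
        ContinuousLinearMap.toExposed.isExposed
      have hne : (l.toExposed (closedBall (0 : X) 1)).Nonempty :=
        ⟨x0, hx0, fun y hy => by
          change g (T y) ≤ g (T x0)
          rw [hgx1]; exact (hgle _).trans (hle y hy)⟩
      obtain ⟨e, he⟩ := (hexp.isCompact hK).extremePoints_nonempty hne
      have heB := hexp.isExtreme.extremePoints_subset_extremePoints he
      have hTe : ‖T e‖ = 1 := by
        apply le_antisymm (hle e heB.1)
        have : g (T x0) ≤ g (T e) := he.1.2 x0 hx0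
        rw [hgx1] at this
        exact this.trans (hgle _)
      rw [hv] at heB
      obtain ⟨i, rfl | rfl⟩ := heB
      · exact ⟨i, hTe⟩
      · exact ⟨i, by simpa using hTe⟩
    obtain ⟨i, hi⟩ := hatt
    have h1 : ⨅ i, κ i ≤ κ i := ciInf_le (Set.finite_range κ).bddBelow i
    have h2 : κ i ≤ ⨆ r, |f i r (T (v i))| := by
      rw [hκ i]
      refine csInf_le ⟨0, ?_⟩ ⟨T (v i), hi, rfl⟩
      rintro _ ⟨x, -, rfl⟩
      exact Real.iSup_nonneg fun _ => abs_nonneg _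
    have h3 : ⨆ r, |f i r (T (v i))| ≤ nrad T := by
      refine Real.iSup_le (fun r => ?_) hnn
      obtain ⟨-, hvF, hf1, w, -, -, hFeq⟩ := hF i r
      rw [hFeq] at hvF
      exact le_csSup hbdd ⟨v i, f i r, by simpa using hvF.2, hf1, hvF.1, rfl⟩
    exact h1.trans (h2.trans h3)
end

section
/- Let n ≥ 2 be even, l ∈ R, and let X be the 3-dimensional real Banach space whose unit ball is the prism with vertices (cos((j−1)π/n) ± l, sin((j−1)π/n), ±1) for j = 1, …, 2n. Then the numerical index of X equals tan(π/(2n)). -/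
open Metric Set Real

/-- Vertices of the (possibly oblique) prism over the regular 2n-gon:
`(cos((j-1)π/n) ± l, sin((j-1)π/n), ±1)`, `j = 1, …, 2n`. -/
def prismVerts (n : ℕ) (l : ℝ) : Set (Fin 3 → ℝ) :=
  {p | ∃ j : Fin (2 * n),
    p = ![Real.cos (j * π / n) + l, Real.sin (j * π / n), 1] ∨
    p = ![Real.cos (j * π / n) - l, Real.sin (j * π / n), -1]}


lemma aux_cos (n : ℕ) (hn : 2 ≤ n) (m : ℤ) :
    |Real.cos ((2 * m + 1) * (π / (2 * n)))| ≤ Real.cos (π / (2 * n)) := by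
  have hn0 : (0 : ℝ) < n := by exact_mod_cast (by omega : 0 < n)
  set h : ℝ := π / (2 * n) with hh
  have hpi : 2 * n * h = π := by rw [hh]; field_simp
  have hpos : 0 < h := by rw [hh]; positivity
  have hnz : (0 : ℤ) < n := by exact_mod_cast (by omega : 0 < n)
  obtain ⟨q, r, hr0, hr1, hm⟩ : ∃ q r : ℤ, 0 ≤ r ∧ r + 1 ≤ n ∧ m = q * n + r :=
    ⟨m / n, m % n, Int.emod_nonneg _ (by omega), Int.emod_lt_of_pos _ hnz, by
      rw [mul_comm]; exact (Int.mul_ediv_add_emod m n).symm⟩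
  have hang : (2 * (m : ℝ) + 1) * h = (2 * r + 1) * h + q * π := by
    rw [hm, ← hpi]; push_cast; ring
  have hr0' : (0 : ℝ) ≤ r := by exact_mod_cast hr0
  have hr1' : (r : ℝ) + 1 ≤ n := by exact_mod_cast hr1
  have hlo : h ≤ (2 * r + 1) * h := by nlinarith
  have hhi : (2 * r + 1) * h ≤ π - h := by rw [← hpi]; nlinarith
  rw [hang, Real.cos_add_int_mul_pi, abs_mul, abs_zpow, abs_neg, abs_one, one_zpow, one_mul, abs_le]
  constructor
  · have := Real.cos_le_cos_of_nonneg_of_le_pi (x := h) (y := π - (2 * r + 1) * h)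
      hpos.le (by linarith) (by linarith)
    rw [Real.cos_pi_sub] at this
    linarith
  · exact Real.cos_le_cos_of_nonneg_of_le_pi hpos.le (by linarith) hlo

lemma aux_sin (n : ℕ) (hn : 2 ≤ n) (heven : Even n) (m : ℤ) :
    |Real.sin ((2 * m + 1) * (π / (2 * n)))| ≤ Real.cos (π / (2 * n)) := by
  have hn0 : (0 : ℝ) < n := by exact_mod_cast (by omega : 0 < n)
  obtain ⟨q, hq⟩ := heven
  have := aux_cos n hn (m - q)
  have h2 : (2 * ((m - q : ℤ) : ℝ) + 1) * (π / (2 * n))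
      = (2 * m + 1) * (π / (2 * n)) - π / 2 := by
    have : (n : ℝ) = q + q := by exact_mod_cast hq
    push_cast
    field_simp
    rw [this]; ring
  rw [h2, Real.cos_sub_pi_div_two] at this
  exact this

lemma aux_real (h1 h2 b v t A B : ℝ) (ht : 1 ≤ t)
    (a1 : |h1 + b| ≤ v) (a2 : |h1 - b| ≤ v) (a3 : |h2 + b| ≤ v) (a4 : |h2 - b| ≤ v)
    (hA : |A| ≤ 1 / 2) (hB : |B| ≤ t / 2) :
    |A * (h1 + h2) + B * (h2 - h1)| + |b| ≤ t * v := by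
  have e1 : |h1| + |b| ≤ v := by
    rw [abs_le] at a1 a2
    cases abs_cases h1 <;> cases abs_cases b <;> linarith
  have e2 : |h2| + |b| ≤ v := by
    rw [abs_le] at a3 a4
    cases abs_cases h2 <;> cases abs_cases b <;> linarith
  have e3 : |h1 + h2| + |h2 - h1| ≤ 2 * (v - |b|) := by
    cases abs_cases h1 <;> cases abs_cases h2 <;> cases abs_cases (h1 + h2) <;>
      cases abs_cases (h2 - h1) <;> linarith
  have e4 : |A * (h1 + h2) + B * (h2 - h1)| ≤ 1 / 2 * |h1 + h2| + t / 2 * |h2 - h1| := by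
    refine (abs_add_le _ _).trans ?_
    rw [abs_mul, abs_mul]
    gcongr
  have := abs_nonneg (h1 + h2)
  have := abs_nonneg b
  nlinarith [mul_nonneg (sub_nonneg.2 ht) (abs_nonneg (h1 + h2)),
    mul_nonneg (sub_nonneg.2 ht) (abs_nonneg b)]

section core
variable {X : Type*} [NormedAddCommGroup X] [NormedSpace ℝ X]

/-- Point of the base circle at angle `φ`. -/
noncomputable def ept (C S : X) (φ : ℝ) : X := Real.cos φ • C + Real.sin φ • S

lemma ept_sector (C S : X) (h φ t : ℝ) (ht : Real.sin h ≠ 0) :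
    ept C S (φ + t) = (Real.sin (h - t) / Real.sin h) • ept C S φ
      + (Real.sin t / Real.sin h) • ept C S (φ + h) := by
  have hc : Real.cos (φ + t) = Real.sin (h - t) / Real.sin h * Real.cos φ
      + Real.sin t / Real.sin h * Real.cos (φ + h) := by
    field_simp
    simp only [Real.cos_add, Real.sin_sub]; ring
  have hs : Real.sin (φ + t) = Real.sin (h - t) / Real.sin h * Real.sin φ
      + Real.sin t / Real.sin h * Real.sin (φ + h) := by
    field_simp
    simp only [Real.sin_add, Real.sin_sub]; ring
  unfold ept
  rw [hc, hs]
  module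

lemma norm_two (E Z : X) (h1 : ‖E + Z‖ ≤ 1) (h2 : ‖E - Z‖ ≤ 1) (σ τ M : ℝ)
    (hσ : |σ| ≤ M) (hτ : |τ| ≤ M) : ‖σ • E + τ • Z‖ ≤ M := by
  have : σ • E + τ • Z = ((σ + τ) / 2) • (E + Z) + ((σ - τ) / 2) • (E - Z) := by module
  rw [this]
  have hb : |(σ + τ) / 2| + |(σ - τ) / 2| ≤ M := by
    rw [abs_le] at hσ hτ
    cases abs_cases ((σ + τ) / 2) <;> cases abs_cases ((σ - τ) / 2) <;> linarith
  calc _ ≤ ‖((σ + τ) / 2) • (E + Z)‖ + ‖((σ - τ) / 2) • (E - Z)‖ := norm_add_le _ _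
    _ = |(σ + τ) / 2| * ‖E + Z‖ + |(σ - τ) / 2| * ‖E - Z‖ := by
        rw [norm_smul, norm_smul, Real.norm_eq_abs, Real.norm_eq_abs]
    _ ≤ |(σ + τ) / 2| * 1 + |(σ - τ) / 2| * 1 := by gcongr
    _ ≤ M := by linarith

lemma norm_le_of_K {Y : Type*} [NormedAddCommGroup Y] [NormedSpace ℝ Y] (T : X →L[ℝ] Y) (M : ℝ)
    (hM : 0 ≤ M) (hT : ∀ x : X, ‖x‖ ≤ 1 → x ∈ {x : X | ‖T x‖ ≤ M}) : ‖T‖ ≤ M := by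
  refine T.opNorm_le_of_unit_norm hM ?_
  intro x hx
  exact hT x hx.le

lemma convex_normK {Y : Type*} [NormedAddCommGroup Y] [NormedSpace ℝ Y] (T : X →L[ℝ] Y) (M : ℝ) :
    Convex ℝ {x : X | ‖T x‖ ≤ M} := by
  have : {x : X | ‖T x‖ ≤ M} = T.toLinearMap ⁻¹' (closedBall (0 : Y) M) := by
    ext x; simp
  rw [this]
  exact (convex_closedBall _ _).linear_preimage _

lemma le_nrad (T : X →L[ℝ] X) (f : X →L[ℝ] ℝ) (x : X) (hf : ‖f‖ ≤ 1) (hx : ‖x‖ ≤ 1)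
    (hfx : f x = 1) : |f (T x)| ≤ nrad T := by
  have h1 : (1 : ℝ) ≤ ‖f‖ * ‖x‖ := by
    have := f.le_opNorm x
    rw [hfx] at this; simpa using this
  have hx1 : ‖x‖ = 1 := by
    have := norm_nonneg x; nlinarith
  have hf1 : ‖f‖ = 1 := by
    have := norm_nonneg f; nlinarith
  apply le_csSup
  · refine ⟨‖T‖, ?_⟩
    rintro r ⟨y, g, hy, hg, -, rfl⟩
    have a := g.le_opNorm (T y)
    have b := T.le_opNorm y
    rw [hg, one_mul] at a
    rw [hy, mul_one] at b
    exact a.trans b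
  · exact ⟨x, f, hx1, hf1, hfx, rfl⟩

set_option maxHeartbeats 1000000 in
lemma core (n : ℕ) (hn : 2 ≤ n) (heven : Even n) (C S Z : X) (c s z : X →L[ℝ] ℝ)
    (hrep : ∀ x, x = c x • C + s x • S + z x • Z)
    (cC : c C = 1) (cS : c S = 0) (cZ : c Z = 0)
    (sC : s C = 0) (sS : s S = 1) (sZ : s Z = 0)
    (zC : z C = 0) (zS : z S = 0) (zZ : z Z = 1)
    (hV1 : ∀ j : ℤ, ‖ept C S (2 * j * (π / (2 * n))) + Z‖ ≤ 1)
    (hV2 : ∀ j : ℤ, ‖ept C S (2 * j * (π / (2 * n))) - Z‖ ≤ 1)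
    (hK : ∀ K : Set X, Convex ℝ K → (∀ j : ℤ, ept C S (2 * j * (π / (2 * n))) + Z ∈ K) →
      (∀ j : ℤ, ept C S (2 * j * (π / (2 * n))) - Z ∈ K) → ∀ x : X, ‖x‖ ≤ 1 → x ∈ K) :
    nindex X = Real.tan (π / (2 * n)) := by
  have hacos := aux_cos n hn
  have hasin := aux_sin n hn heven
  have hn0 : (2 : ℝ) ≤ n := by exact_mod_cast hn
  have hpi : 2 * n * (π / (2 * n)) = π := by field_simp
  have hpos : 0 < π / (2 * n) := by positivity
  generalize π / (2 * n) = h at *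
  have hle : h ≤ π / 4 := by nlinarith
  have hpp := Real.pi_pos
  have hsin : 0 < Real.sin h := Real.sin_pos_of_pos_of_lt_pi hpos (by linarith)
  have hcos : 0 < Real.cos h := Real.cos_pos_of_mem_Ioo ⟨by linarith, by linarith⟩
  have hsc : Real.sin h ≤ Real.cos h := by
    rw [← Real.cos_pi_div_two_sub]
    exact Real.cos_le_cos_of_nonneg_of_le_pi hpos.le (by linarith) (by linarith)
  have hsin2 : 0 < Real.sin (2 * h) := by rw [Real.sin_two_mul]; positivity
  have hcos2 : 0 ≤ Real.cos (2 * h) := by rw [Real.cos_two_mul']; nlinarith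
  have ht : 1 ≤ Real.cos h / Real.sin h := by rw [le_div_iff₀ hsin]; linarith
  have htan : Real.tan h = Real.sin h / Real.cos h := Real.tan_eq_sin_div_cos h
  have cE : ∀ φ, c (ept C S φ) = Real.cos φ := by intro φ; simp [ept, cC, cS]
  have sE : ∀ φ, s (ept C S φ) = Real.sin φ := by intro φ; simp [ept, sC, sS]
  have zE : ∀ φ, z (ept C S φ) = 0 := by intro φ; simp [ept, zC, zS]
  let F : ℤ → (X →L[ℝ] ℝ) := fun k =>
    (Real.cos ((2 * k + 1) * h) / Real.cos h) • c + (Real.sin ((2 * k + 1) * h) / Real.cos h) • s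
  have FE : ∀ k φ, F k (ept C S φ) = Real.cos (φ - (2 * k + 1) * h) / Real.cos h := by
    intro k φ
    simp only [F, add_apply, smul_apply, cE, sE,
      smul_eq_mul, Real.cos_sub]
    ring
  have FZ : ∀ k, F k Z = 0 := by intro k; simp [F, cZ, sZ]
  have FV : ∀ k j : ℤ, |F k (ept C S (2 * j * h))| ≤ 1 := by
    intro k j
    rw [FE, abs_div, abs_of_pos hcos, div_le_one hcos]
    have := hacos (j - k - 1)
    rw [show 2 * (j : ℝ) * h - (2 * k + 1) * h = (2 * ((j - k - 1 : ℤ) : ℝ) + 1) * h by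
      push_cast; ring]
    exact this
  have Fn : ∀ k, ‖F k‖ ≤ 1 := by
    intro k
    refine norm_le_of_K _ _ zero_le_one (hK _ (convex_normK (F k) 1) ?_ ?_)
    · intro j; simpa [FZ] using FV k j
    · intro j; simpa [FZ] using FV k j
  have zn : ‖z‖ ≤ 1 := by
    refine norm_le_of_K _ _ zero_le_one (hK _ (convex_normK z 1) ?_ ?_)
    · intro j; simp [zE, zZ]
    · intro j; simp [zE, zZ]
  have Fk0 : ∀ k : ℤ, F k (ept C S (2 * k * h)) = 1 := by
    intro k
    rw [FE, show 2 * (k : ℝ) * h - (2 * k + 1) * h = -h by ring, Real.cos_neg, div_self hcos.ne']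
  have Fk1 : ∀ k : ℤ, F k (ept C S (2 * (k + 1 : ℤ) * h)) = 1 := by
    intro k
    rw [FE, show 2 * ((k + 1 : ℤ) : ℝ) * h - (2 * k + 1) * h = h by push_cast; ring,
      div_self hcos.ne']
  have hH : ∀ y M, (∀ k, |F k y| ≤ M) → |z y| ≤ M → ‖y‖ ≤ M := by
    intro y M hF hz
    have hpol : ∃ r φ : ℝ, 0 ≤ r ∧ c y = r * Real.cos φ ∧ s y = r * Real.sin φ := by
      refine ⟨‖(⟨c y, s y⟩ : ℂ)‖, Complex.arg ⟨c y, s y⟩, norm_nonneg _, ?_, ?_⟩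
      · rw [Complex.norm_mul_cos_arg]
      · rw [Complex.norm_mul_sin_arg]
    obtain ⟨r, φ, hr, hc, hs⟩ := hpol
    have hy : y = r • ept C S φ + z y • Z := by
      conv_lhs => rw [hrep y, hc, hs]
      unfold ept; module
    set k : ℤ := ⌊φ / (2 * h)⌋ with hk
    have k1 : (k : ℝ) * (2 * h) ≤ φ := by
      rw [← le_div_iff₀ (by positivity)]; exact Int.floor_le _
    have k2 : φ < (k + 1 : ℝ) * (2 * h) := by
      rw [← div_lt_iff₀ (by positivity)]; exact Int.lt_floor_add_one _
    have hsec := ept_sector C S (2 * h) (2 * k * h) (φ - 2 * k * h) hsin2.ne'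
    rw [show 2 * (k : ℝ) * h + (φ - 2 * k * h) = φ by ring,
      show 2 * (k : ℝ) * h + 2 * h = 2 * ((k + 1 : ℤ) : ℝ) * h by push_cast; ring] at hsec
    have ha : 0 ≤ r * (Real.sin (2 * h - (φ - 2 * k * h)) / Real.sin (2 * h)) := by
      refine mul_nonneg hr (div_nonneg (Real.sin_nonneg_of_nonneg_of_le_pi ?_ ?_) hsin2.le) <;>
        linarith
    have hb : 0 ≤ r * (Real.sin (φ - 2 * k * h) / Real.sin (2 * h)) := by
      refine mul_nonneg hr (div_nonneg (Real.sin_nonneg_of_nonneg_of_le_pi ?_ ?_) hsin2.le) <;>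
        linarith
    rw [hsec, smul_add, smul_smul, smul_smul] at hy
    generalize r * (Real.sin (2 * h - (φ - 2 * k * h)) / Real.sin (2 * h)) = a at *
    generalize r * (Real.sin (φ - 2 * k * h) / Real.sin (2 * h)) = b at *
    have hab : F k y = a + b := by
      rw [hy]
      simp only [map_add, map_smul, Fk0, Fk1, FZ, smul_eq_mul]; ring
    have hM : |a + b| ≤ M := hab ▸ hF k
    have n1 := norm_two _ Z (hV1 k) (hV2 k) (a + b) (z y) M hM hz
    have n2 := norm_two _ Z (hV1 (k + 1)) (hV2 (k + 1)) (a + b) (z y) M hM hz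
    rcases eq_or_lt_of_le (add_nonneg ha hb) with h0 | h0
    · have a0 : a = 0 := by linarith
      have b0 : b = 0 := by linarith
      rw [a0, b0] at hy n1
      rw [hy]
      simpa using n1
    · have hconv := (convex_closedBall (0 : X) M) (mem_closedBall_zero_iff.2 n1)
        (mem_closedBall_zero_iff.2 n2) (div_nonneg ha h0.le) (div_nonneg hb h0.le)
        (by field_simp)
      rw [mem_closedBall_zero_iff] at hconv
      refine le_of_eq_of_le (congrArg norm ?_) hconv
      refine hy.trans ?_
      have e1 : a / (a + b) * (a + b) = a := by field_simp
      have e2 : b / (a + b) * (a + b) = b := by field_simp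
      have e3 : a / (a + b) * z y + b / (a + b) * z y = z y := by field_simp
      rw [smul_add, smul_add, smul_smul, smul_smul, smul_smul, smul_smul, e1, e2]
      generalize z y = w at *
      have e4 : w • Z = (a / (a + b) * w) • Z + (b / (a + b) * w) • Z := by rw [← add_smul, e3]
      rw [e4]; abel
  have hlow : ∀ T : X →L[ℝ] X, ‖T‖ = 1 → Real.tan h ≤ nrad T := by
    intro T hT
    set v := nrad T with hv
    have P1 : ∀ k j : ℤ, F k (ept C S (2 * j * h)) = 1 →
        |F k (T (ept C S (2 * j * h))) + F k (T Z)| ≤ v := by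
      intro k j hkj
      have := le_nrad T (F k) _ (Fn k) (hV1 j) (by rw [map_add, hkj, FZ, add_zero])
      rwa [map_add, map_add] at this
    have P2 : ∀ k j : ℤ, F k (ept C S (2 * j * h)) = 1 →
        |F k (T (ept C S (2 * j * h))) - F k (T Z)| ≤ v := by
      intro k j hkj
      have := le_nrad T (F k) _ (Fn k) (hV2 j) (by rw [map_sub, hkj, FZ, sub_zero])
      rwa [map_sub, map_sub] at this
    have Q1 : ∀ j : ℤ, |z (T (ept C S (2 * j * h) + Z))| ≤ v := by
      intro j
      exact le_nrad T z _ zn (hV1 j) (by rw [map_add, zE, zZ, zero_add])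
    have Q2 : ∀ j : ℤ, |z (T (ept C S (2 * j * h) - Z))| ≤ v := by
      intro j
      have := le_nrad T (-z) _ (by rwa [norm_neg]) (hV2 j) (by simp [zE, zZ])
      rwa [neg_apply, abs_neg] at this
    have hv0 : 0 ≤ v := (abs_nonneg _).trans (Q1 0)
    set M := Real.cos h / Real.sin h * v with hM
    have hvM : v ≤ M := by rw [hM]; nlinarith
    have key : ∀ k j : ℤ, |F k (T (ept C S (2 * j * h)))| + |F k (T Z)| ≤ M := by
      intro k j
      have hE : ept C S (2 * j * h) =
          (Real.cos ((2 * (j - k - 1 : ℤ) + 1) * h) / (2 * Real.cos h)) •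
            (ept C S (2 * k * h) + ept C S (2 * (k + 1 : ℤ) * h)) +
          (Real.sin ((2 * (j - k - 1 : ℤ) + 1) * h) / (2 * Real.sin h)) •
            (ept C S (2 * (k + 1 : ℤ) * h) - ept C S (2 * k * h)) := by
        set m := (2 * (k : ℝ) + 1) * h with hm
        set ψ := (2 * ((j - k - 1 : ℤ) : ℝ) + 1) * h with hψ
        rw [show 2 * (j : ℝ) * h = m + ψ by rw [hm, hψ]; push_cast; ring,
          show 2 * (k : ℝ) * h = m - h by rw [hm]; ring,
          show 2 * ((k + 1 : ℤ) : ℝ) * h = m + h by rw [hm]; push_cast; ring]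
        simp only [ept, Real.cos_add, Real.sin_add, Real.cos_sub, Real.sin_sub]
        match_scalars <;> field_simp <;> ring
      rw [hE]
      simp only [map_add, map_smul, map_sub, smul_eq_mul]
      refine aux_real _ _ _ v _ _ _ ht (P1 k k (Fk0 k)) (P2 k k (Fk0 k)) (P1 k (k+1) (Fk1 k))
        (P2 k (k+1) (Fk1 k)) ?_ ?_
      · rw [abs_div, abs_of_pos (by positivity : 0 < 2 * Real.cos h), div_le_iff₀ (by positivity)]
        linarith [hacos (j - k - 1)]
      · rw [abs_div, abs_of_pos (by positivity : 0 < 2 * Real.sin h), div_le_iff₀ (by positivity)]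
        have := hasin (j - k - 1)
        have e : Real.cos h / Real.sin h / 2 * (2 * Real.sin h) = Real.cos h := by field_simp
        rw [e]; exact this
    have hnorm : ‖T‖ ≤ M := by
      refine norm_le_of_K _ _ (hv0.trans hvM) (hK _ (convex_normK T M) ?_ ?_)
      · intro j
        refine hH _ _ (fun k => ?_) ((Q1 j).trans hvM)
        rw [map_add, map_add]
        exact (abs_add_le _ _).trans (key k j)
      · intro j
        refine hH _ _ (fun k => ?_) ((Q2 j).trans hvM)
        rw [map_sub, map_sub]
        exact (abs_sub _ _).trans (key k j)
    rw [hT, hM, div_mul_eq_mul_div, le_div_iff₀ hsin] at hnorm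
    rw [htan, div_le_iff₀ hcos]
    linarith
  obtain ⟨q, hq⟩ := heven
  have hqh : 2 * (q : ℝ) * h = π / 2 := by
    have : (n : ℝ) = q + q := by exact_mod_cast hq
    rw [← hpi, this]; ring
  let T : X →L[ℝ] X := c.smulRight S - s.smulRight C
  have Tdef : ∀ x, T x = c x • S - s x • C := fun x => rfl
  have TE : ∀ φ, T (ept C S φ) = ept C S (φ + π / 2) := by
    intro φ
    rw [Tdef, cE, sE, ept, Real.cos_add_pi_div_two, Real.sin_add_pi_div_two]; module
  have TZ : T Z = 0 := by rw [Tdef, cZ, sZ]; simp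
  have TV : ∀ j : ℤ, T (ept C S (2 * j * h)) = ept C S (2 * (j + q : ℤ) * h) := by
    intro j
    rw [TE, ← hqh]; congr 1; push_cast; ring
  have hE1 : ∀ j : ℤ, ‖ept C S (2 * j * h)‖ ≤ 1 := by
    intro j
    have := norm_two _ Z (hV1 j) (hV2 j) 1 0 1 (by simp) (by simp)
    simpa using this
  have hT1 : ‖T‖ ≤ 1 := by
    refine norm_le_of_K _ _ zero_le_one (hK _ (convex_normK T 1) ?_ ?_)
    · intro j
      rw [Set.mem_ofPred_eq, map_add, TV, TZ, add_zero]; exact hE1 _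
    · intro j
      rw [Set.mem_ofPred_eq, map_sub, TV, TZ, sub_zero]; exact hE1 _
  have TC : T C = S := by rw [Tdef, cC, sC]; simp
  have TS : T S = -C := by rw [Tdef, cS, sS]; simp
  have hC0 : 0 < ‖C‖ := by
    rw [norm_pos_iff]
    intro h0; rw [h0, map_zero] at cC; exact zero_ne_one cC
  have hT2 : 1 ≤ ‖T‖ := by
    have a := T.le_opNorm C
    have b := T.le_opNorm S
    rw [TC] at a
    rw [TS, norm_neg] at b
    by_contra hlt
    push Not at hlt
    have := norm_nonneg T
    have := norm_nonneg S
    nlinarith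
  have hTn : ‖T‖ = 1 := le_antisymm hT1 hT2
  have hup : nrad T ≤ Real.tan h := by
    refine Real.sSup_le ?_ (by rw [htan]; positivity)
    rintro r ⟨x, f, hx, hf, hfx, rfl⟩
    have hfle : ∀ y, ‖y‖ ≤ 1 → f y ≤ 1 := by
      intro y hy
      have := f.le_opNorm y
      rw [hf, one_mul] at this
      exact (le_abs_self _).trans (this.trans hy)
    have half : ∀ g : X →L[ℝ] ℝ, ∀ M : ℝ, (∀ j : ℤ, g (ept C S (2 * j * h) + Z) ≤ M) →
      (∀ j : ℤ, g (ept C S (2 * j * h) - Z) ≤ M) → g x ≤ M := by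
      intro g M h1 h2
      exact hK {y | g y ≤ M} (convex_halfSpace_le g.toLinearMap.isLinear M) h1 h2 x hx.le
    have hnext : ∀ j : ℤ, ept C S (2 * (j + 1 : ℤ) * h) =
        Real.cos (2 * h) • ept C S (2 * j * h) + Real.sin (2 * h) • T (ept C S (2 * j * h)) := by
      intro j
      rw [TE, show 2 * ((j + 1 : ℤ) : ℝ) * h = 2 * j * h + 2 * h by push_cast; ring]
      generalize 2 * (j : ℝ) * h = φ
      simp only [ept, Real.cos_add, Real.sin_add, Real.cos_pi_div_two, Real.sin_pi_div_two]
      module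
    have hprev : ∀ j : ℤ, ept C S (2 * (j - 1 : ℤ) * h) =
        Real.cos (2 * h) • ept C S (2 * j * h) - Real.sin (2 * h) • T (ept C S (2 * j * h)) := by
      intro j
      rw [TE, show 2 * ((j - 1 : ℤ) : ℝ) * h = 2 * j * h - 2 * h by push_cast; ring]
      generalize 2 * (j : ℝ) * h = φ
      simp only [ept, Real.cos_add_pi_div_two, Real.sin_add_pi_div_two, Real.cos_sub, Real.sin_sub]
      module
    have hc1 : Real.cos (2 * h) ≤ 1 := Real.cos_le_one _
    have up1 : Real.sin (2 * h) * f (T x) + f x ≤ 2 - Real.cos (2 * h) := by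
      refine half (Real.sin (2 * h) • f.comp T + f) _ ?_ ?_
      · intro j
        have a := hfle _ (hV1 (j + 1))
        have b := mul_nonneg (sub_nonneg.2 hc1) (sub_nonneg.2 (hfle _ (hE1 j)))
        rw [hnext] at a
        simp only [map_add, map_smul, smul_eq_mul] at a
        simp only [add_apply, smul_apply,
          ContinuousLinearMap.comp_apply, map_add, TZ, map_zero, smul_eq_mul]
        linarith
      · intro j
        have a := hfle _ (hV2 (j + 1))
        have b := mul_nonneg (sub_nonneg.2 hc1) (sub_nonneg.2 (hfle _ (hE1 j)))
        rw [hnext] at a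
        simp only [map_add, map_sub, map_smul, smul_eq_mul] at a
        simp only [add_apply, smul_apply,
          ContinuousLinearMap.comp_apply, map_sub, TZ, map_zero, smul_eq_mul]
        linarith
    have up2 : -(Real.sin (2 * h)) * f (T x) + f x ≤ 2 - Real.cos (2 * h) := by
      refine half ((-(Real.sin (2 * h))) • f.comp T + f) _ ?_ ?_
      · intro j
        have a := hfle _ (hV1 (j - 1))
        have b := mul_nonneg (sub_nonneg.2 hc1) (sub_nonneg.2 (hfle _ (hE1 j)))
        rw [hprev] at a
        simp only [map_add, map_sub, map_smul, smul_eq_mul] at a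
        simp only [add_apply, smul_apply,
          ContinuousLinearMap.comp_apply, map_add, TZ, map_zero, smul_eq_mul]
        linarith
      · intro j
        have a := hfle _ (hV2 (j - 1))
        have b := mul_nonneg (sub_nonneg.2 hc1) (sub_nonneg.2 (hfle _ (hE1 j)))
        rw [hprev] at a
        simp only [map_sub, map_smul, smul_eq_mul] at a
        simp only [add_apply, smul_apply,
          ContinuousLinearMap.comp_apply, map_sub, TZ, map_zero, smul_eq_mul]
        linarith
    have fin : |f (T x)| * Real.sin (2 * h) ≤ 1 - Real.cos (2 * h) := by
      cases abs_cases (f (T x)) <;> nlinarith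
    rw [htan, le_div_iff₀ hcos]
    rw [Real.sin_two_mul, Real.cos_two_mul'] at fin
    have hsq := Real.sin_sq_add_cos_sq h
    have : (|f (T x)| * Real.cos h) * (2 * Real.sin h) ≤ Real.sin h * (2 * Real.sin h) := by
      nlinarith
    exact le_of_mul_le_mul_right this (by positivity)
  have hmem : nrad T ∈ {r : ℝ | ∃ T : X →L[ℝ] X, ‖T‖ = 1 ∧ r = nrad T} := ⟨T, hTn, rfl⟩
  apply le_antisymm
  · refine (csInf_le ⟨Real.tan h, ?_⟩ hmem).trans hup
    rintro r ⟨T', hT', rfl⟩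
    exact hlow T' hT'
  · refine le_csInf ⟨_, hmem⟩ ?_
    rintro r ⟨T', hT', rfl⟩
    exact hlow T' hT'

end core

theorem stmt_8 {X : Type*} [NormedAddCommGroup X] [NormedSpace ℝ X]
    (n : ℕ) (hn : 2 ≤ n) (heven : Even n) (l : ℝ)
    (e : X ≃ₗ[ℝ] (Fin 3 → ℝ))
    (hball : closedBall (0 : X) 1 = e ⁻¹' (convexHull ℝ (prismVerts n l))) :
    nindex X = Real.tan (π / (2 * n)) := by
  have hfd : FiniteDimensional ℝ X := LinearEquiv.finiteDimensional e.symm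
  have hn0 : (0 : ℝ) < n := by exact_mod_cast (by omega : 0 < n)
  let p : Fin 3 → (X →ₗ[ℝ] ℝ) := fun i => (LinearMap.proj i).comp e.toLinearMap
  have hp : ∀ i x, p i x = e x i := fun i x => rfl
  let c : X →L[ℝ] ℝ := LinearMap.toContinuousLinearMap (p 0 - l • p 2)
  let s : X →L[ℝ] ℝ := LinearMap.toContinuousLinearMap (p 1)
  let z : X →L[ℝ] ℝ := LinearMap.toContinuousLinearMap (p 2)
  have hc : ∀ x, c x = e x 0 - l * e x 2 := fun x => rfl
  have hs : ∀ x, s x = e x 1 := fun x => rfl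
  have hz : ∀ x, z x = e x 2 := fun x => rfl
  let C : X := e.symm ![1, 0, 0]
  let S : X := e.symm ![0, 1, 0]
  let Z : X := e.symm ![l, 0, 1]
  have eC : e C = ![1, 0, 0] := e.apply_symm_apply _
  have eS : e S = ![0, 1, 0] := e.apply_symm_apply _
  have eZ : e Z = ![l, 0, 1] := e.apply_symm_apply _
  have e1 : ∀ φ, e (ept C S φ + Z) = ![Real.cos φ + l, Real.sin φ, 1] := by
    intro φ
    simp only [ept, map_add, map_smul, eC, eS, eZ]
    ext i; fin_cases i <;> simp
  have e2 : ∀ φ, e (ept C S φ - Z) = ![Real.cos φ - l, Real.sin φ, -1] := by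
    intro φ
    simp only [ept, map_add, map_sub, map_smul, eC, eS, eZ]
    ext i; fin_cases i <;> simp
  have hj : ∀ j : ℤ, ∃ i : Fin (2 * n),
      Real.cos (2 * j * (π / (2 * n))) = Real.cos (i * π / n) ∧
      Real.sin (2 * j * (π / (2 * n))) = Real.sin (i * π / n) := by
    intro j
    have hnz : (0 : ℤ) < 2 * n := by omega
    obtain ⟨q, r, hr0, hr1, hm⟩ : ∃ q r : ℤ, 0 ≤ r ∧ r < 2 * n ∧ j = q * (2 * n) + r :=
      ⟨j / (2 * n), j % (2 * n), Int.emod_nonneg _ (by omega), Int.emod_lt_of_pos _ hnz, by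
        rw [mul_comm]; exact (Int.mul_ediv_add_emod j (2 * n)).symm⟩
    lift r to ℕ using hr0
    refine ⟨⟨r, by omega⟩, ?_⟩
    have hang : 2 * (j : ℝ) * (π / (2 * n)) = r * π / n + q * (2 * π) := by
      rw [hm]; push_cast; field_simp; ring
    rw [hang]
    exact ⟨Real.cos_add_int_mul_two_pi _ _, Real.sin_add_int_mul_two_pi _ _⟩
  have hmem : ∀ x, e x ∈ convexHull ℝ (prismVerts n l) ↔ ‖x‖ ≤ 1 := by
    intro x
    rw [← mem_closedBall_zero_iff, hball]; rfl
  refine core n hn heven C S Z c s z ?_ ?_ ?_ ?_ ?_ ?_ ?_ ?_ ?_ ?_ ?_ ?_ ?_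
  · intro x
    apply e.injective
    simp only [map_add, map_smul, eC, eS, eZ, hc, hs, hz]
    ext i; fin_cases i <;> simp <;> ring
  · simp [hc, eC]
  · simp [hc, eS]
  · simp [hc, eZ]
  · simp [hs, eC]
  · simp [hs, eS]
  · simp [hs, eZ]
  · simp [hz, eC]
  · simp [hz, eS]
  · simp [hz, eZ]
  · intro j
    obtain ⟨i, h1, h2⟩ := hj j
    rw [← hmem, e1, h1, h2]
    exact subset_convexHull _ _ ⟨i, Or.inl rfl⟩
  · intro j
    obtain ⟨i, h1, h2⟩ := hj j
    rw [← hmem, e2, h1, h2]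
    exact subset_convexHull _ _ ⟨i, Or.inr rfl⟩
  · intro K hKc hK1 hK2 x hx
    have hsub : convexHull ℝ (prismVerts n l) ⊆ e.symm.toLinearMap ⁻¹' K := by
      refine convexHull_min ?_ (hKc.linear_preimage _)
      rintro v ⟨i, hv | hv⟩
      · have := hK1 (i : ℕ)
        have h3 : e.symm v = ept C S (2 * ((i : ℕ) : ℤ) * (π / (2 * n))) + Z := by
          rw [LinearEquiv.symm_apply_eq, e1, hv]
          rw [show 2 * (((i : ℕ) : ℤ) : ℝ) * (π / (2 * n)) = i * π / n by
            push_cast; field_simp]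
        change e.symm v ∈ K
        rw [h3]; exact this
      · have := hK2 (i : ℕ)
        have h3 : e.symm v = ept C S (2 * ((i : ℕ) : ℤ) * (π / (2 * n))) - Z := by
          rw [LinearEquiv.symm_apply_eq, e2, hv]
          rw [show 2 * (((i : ℕ) : ℤ) : ℝ) * (π / (2 * n)) = i * π / n by
            push_cast; field_simp]
        change e.symm v ∈ K
        rw [h3]; exact this
    have := hsub ((hmem x).2 hx)
    simpa using this
end

section
/- Let n ≥ 3 and let X be the 3-dimensional Banach space whose unit ball is the polyhedron with vertices (cos((j−1)π/n), sin((j−1)π/n), ±1) for j = 1, …, 2n together with (0,0,±2). Then n(X) = sin(π/(2n)) if n is odd and n(X) = tan(π/(2n)) if n is even. -/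
open Metric Set Real

/-- Vertices `(cos((j-1)π/n), sin((j-1)π/n), ±1)`, `j = 1, …, 2n`,
together with the apexes `(0,0,±2)`. -/
def prismPyramidVerts (n : ℕ) : Set (Fin 3 → ℝ) :=
  {p | (∃ j : Fin (2 * n),
      p = ![Real.cos (j * π / n), Real.sin (j * π / n), 1] ∨
      p = ![Real.cos (j * π / n), Real.sin (j * π / n), -1]) ∨
    p = ![0, 0, 2] ∨ p = ![0, 0, -2]}

/-! ### Trigonometry -/

lemma sin_mult_aux (N : ℕ) (hN : 2 ≤ N) (l : ℤ) :
    Real.sin (l * (π / N)) = 0 ∨ Real.sin (π / N) ≤ |Real.sin (l * (π / N))| := by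
  have hN0 : (0:ℝ) < N := by positivity
  have hpi := Real.pi_pos
  have hNz : (0:ℤ) < N := by omega
  obtain ⟨q, r, hr0, hrN, hl⟩ : ∃ q r : ℤ, 0 ≤ r ∧ r < N ∧ l = r + q * N :=
    ⟨l / N, l % N, Int.emod_nonneg _ hNz.ne', Int.emod_lt_of_pos _ hNz, by
      rw [mul_comm]; exact (Int.emod_add_mul_ediv l N).symm⟩
  have h1 : (l:ℝ) * (π / N) = r * (π / N) + q * π := by
    rw [hl]; push_cast; field_simp
  have h2 : |Real.sin (l * (π / N))| = |Real.sin (r * (π / N))| := by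
    rw [h1, Real.sin_add_int_mul_pi]
    rcases Int.even_or_odd q with h | h
    · simp [h.neg_one_zpow]
    · simp [h.neg_one_zpow]
  rcases eq_or_lt_of_le hr0 with h | h
  · left
    rw [← abs_eq_zero, h2, ← h]; simp
  · right
    rw [h2]
    refine le_trans ?_ (le_abs_self _)
    have hr1 : (1:ℝ) ≤ r := by exact_mod_cast h
    have hr2 : (r:ℝ) ≤ N - 1 := by
      have : r ≤ (N:ℤ) - 1 := by omega
      exact_mod_cast this
    set d := π / N with hd
    have hd0 : 0 < d := by positivity
    have hNd : N * d = π := by rw [hd]; field_simp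
    have hN2 : (2:ℝ) ≤ N := by exact_mod_cast hN
    rcases le_total (r * d) (π / 2) with h3 | h3
    · exact Real.sin_le_sin_of_le_of_le_pi_div_two (by nlinarith) h3 (by nlinarith)
    · rw [← Real.sin_pi_sub (r * d)]
      exact Real.sin_le_sin_of_le_of_le_pi_div_two (by nlinarith) (by linarith) (by nlinarith)

/-- The basic angle `π / (2n)`. -/
noncomputable def th (n : ℕ) : ℝ := π / (2 * n)


lemma n_th {n : ℕ} (hn : 3 ≤ n)
    : (n:ℝ) * th n = π / 2 := by
  have : (0:ℝ) < n := by positivity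
  unfold th; field_simp

lemma th_pos {n : ℕ} (hn : 3 ≤ n)
    : 0 < th n := by
  have : (0:ℝ) < n := by positivity
  have := Real.pi_pos
  unfold th; positivity

lemma th_le {n : ℕ} (hn : 3 ≤ n)
    : th n ≤ π / 6 := by
  have h : (3:ℝ) ≤ n := by exact_mod_cast hn
  have := n_th hn
  have := th_pos hn
  nlinarith

lemma sin_th_pos {n : ℕ} (hn : 3 ≤ n)
    : 0 < Real.sin (th n) :=
  Real.sin_pos_of_pos_of_lt_pi (th_pos hn) (by have := th_le hn; have := Real.pi_pos; linarith)

lemma cos_th_pos {n : ℕ} (hn : 3 ≤ n)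
    : 0 < Real.cos (th n) :=
  Real.cos_pos_of_mem_Ioo ⟨by have := th_pos hn; have := Real.pi_pos; linarith,
    by have := th_le hn; have := Real.pi_pos; linarith⟩

lemma sin_th_le {n : ℕ} (hn : 3 ≤ n)
    : Real.sin (th n) ≤ 1 / 2 := by
  rw [← Real.sin_pi_div_six]
  have := th_le hn
  have := th_pos hn
  have := Real.pi_pos
  exact Real.sin_le_sin_of_le_of_le_pi_div_two (by linarith) (by linarith) (by linarith)

lemma sin_odd {n : ℕ} (hn : 3 ≤ n)
    (m : ℤ) (hm : Odd m) : Real.sin (th n) ≤ |Real.sin (m * th n)| := by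
  have h := sin_mult_aux (2 * n) (by omega) m
  have h2 : π / ((2 * n : ℕ) : ℝ) = th n := by unfold th; push_cast; rfl
  rw [h2] at h
  rcases h with h | h
  · exfalso
    rw [Real.sin_eq_zero_iff] at h
    obtain ⟨k, hk⟩ := h
    have h3 := n_th hn
    have h4 : ((k * (2 * n) : ℤ) : ℝ) * th n = (m:ℝ) * th n := by
      push_cast; rw [← hk]; linear_combination 2 * k * h3
    have h5 := mul_right_cancel₀ (th_pos hn).ne' h4
    have h6 : k * (2 * n) = m := by exact_mod_cast h5
    obtain ⟨i, hi⟩ := hm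
    have : m = 2 * (k * n) := by rw [← h6]; ring
    omega
  · exact h

lemma sin_even {n : ℕ} (hn : 3 ≤ n)
    (m : ℤ) : Real.sin (2 * m * th n) = 0 ∨
    Real.sin (2 * th n) ≤ |Real.sin (2 * m * th n)| := by
  have h := sin_mult_aux n (by omega) m
  have h2 : π / (n : ℝ) = 2 * th n := by
    have : (0:ℝ) < n := by positivity
    unfold th; field_simp
  rw [h2] at h
  rw [show 2 * (m:ℝ) * th n = m * (2 * th n) by ring]
  exact h

lemma cos_odd {n : ℕ} (hn : 3 ≤ n)
    (m : ℤ) (hm : Odd m) : |Real.cos (m * th n)| ≤ Real.cos (th n) := by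
  have h := sin_odd hn m hm
  apply abs_le_of_sq_le_sq _ (cos_th_pos hn).le
  have h1 := Real.sin_sq_add_cos_sq (m * th n)
  have h2 := Real.sin_sq_add_cos_sq (th n)
  have h3 := sin_th_pos hn
  have h4 := sq_abs (Real.sin (m * th n))
  nlinarith

/-- the upper bound for `sin (mθ)`; `t` is the numerical index. -/
lemma sin_odd_le {n : ℕ} (hn : 3 ≤ n)
    (m : ℤ) (hm : Odd m) (he : Even n) :
    |Real.sin (m * th n)| ≤ Real.cos (th n) := by
  have h := cos_odd hn (n - m) (by
    have : Even (n:ℤ) := by exact_mod_cast he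
    exact this.sub_odd hm)
  have : ((n - m : ℤ) : ℝ) * th n = π / 2 - m * th n := by
    push_cast; rw [sub_mul, n_th hn]
  rwa [this, Real.cos_pi_div_two_sub] at h


/-! ### the real inequality -/

lemma two_bound {r α β l u K : ℝ} (hα : |α| ≤ r) (hβ : |β| ≤ r) (hK : |l| + |u| ≤ K) :
    |l * α + u * β| ≤ K * r := by
  have hr : 0 ≤ r := (abs_nonneg _).trans hα
  calc |l * α + u * β| ≤ |l| * |α| + |u| * |β| := by
        rw [← abs_mul, ← abs_mul]; exact abs_add_le _ _
    _ ≤ |l| * r + |u| * r := by gcongr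
    _ = (|l| + |u|) * r := by ring
    _ ≤ K * r := by gcongr

lemma top_bound {r α β w l u K : ℝ} (hα : |α| ≤ r) (hβ : |β| ≤ r)
    (hαw : |α + w| ≤ 2 * r) (hβw : |β + w| ≤ 2 * r) (hl : 1 ≤ |l|) (hu : 1 ≤ |u|)
    (hlu : l * u ≤ 0) (hK : |l| + |u| ≤ K) :
    |l * α + u * β| + |w| ≤ K * r + r := by
  have hr : 0 ≤ r := (abs_nonneg _).trans hα
  have hKr : (|l| + |u|) * r ≤ K * r := by gcongr
  rw [abs_le] at hα hβ hαw hβw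
  suffices h : |l * α + u * β| + |w| ≤ (|l| + |u|) * r + r by linarith
  rcases abs_cases l with ⟨e1, _⟩ | ⟨e1, _⟩ <;> rcases abs_cases u with ⟨e2, _⟩ | ⟨e2, _⟩ <;>
  rw [e1] at hl ⊢ <;> rw [e2] at hu ⊢ <;>
  rcases abs_cases (l * α + u * β) with ⟨e3, _⟩ | ⟨e3, _⟩ <;>
  rcases abs_cases w with ⟨e4, _⟩ | ⟨e4, _⟩ <;> rw [e3, e4] <;> nlinarith

/-! ### geometry -/

/-- linear functionals on `ℝ³` -/
noncomputable def lf (a b c : ℝ) : (Fin 3 → ℝ) →ₗ[ℝ] ℝ :=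
  a • LinearMap.proj 0 + b • LinearMap.proj 1 + c • LinearMap.proj 2

lemma lf_apply (a b c : ℝ) (y : Fin 3 → ℝ) : lf a b c y = a * y 0 + b * y 1 + c * y 2 := by
  simp [lf]

/-- side functional in direction `ψ` -/
noncomputable def Fs (n : ℕ) (ψ : ℝ) : (Fin 3 → ℝ) →ₗ[ℝ] ℝ :=
  lf (Real.cos ψ / Real.cos (th n)) (Real.sin ψ / Real.cos (th n)) 0

/-- roof functional in direction `ψ` -/
noncomputable def Gs (n : ℕ) (ψ s : ℝ) : (Fin 3 → ℝ) →ₗ[ℝ] ℝ :=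
  lf (Real.cos ψ / Real.cos (th n) / 2) (Real.sin ψ / Real.cos (th n) / 2) (s / 2)

lemma Fs_apply (n : ℕ) (ψ : ℝ) (y : Fin 3 → ℝ) :
    Fs n ψ y = (Real.cos ψ * y 0 + Real.sin ψ * y 1) / Real.cos (th n) := by
  rw [Fs, lf_apply]; ring

lemma Gs_apply (n : ℕ) (ψ s : ℝ) (y : Fin 3 → ℝ) :
    Gs n ψ s y = (Fs n ψ y + s * y 2) / 2 := by
  rw [Gs, Fs, lf_apply, lf_apply]; ring

/-- vertices with integer index -/
noncomputable def Pv (n : ℕ) (j : ℤ) (s : ℝ) : Fin 3 → ℝ :=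
  ![Real.cos (2 * j * th n), Real.sin (2 * j * th n), s]

lemma Fs_Pv (n : ℕ) (ψ : ℝ) (j : ℤ) (s : ℝ) :
    Fs n ψ (Pv n j s) = Real.cos (ψ - 2 * j * th n) / Real.cos (th n) := by
  rw [Fs_apply, Real.cos_sub]; simp [Pv]


lemma Pv_mem {n : ℕ} (hn : 3 ≤ n)
    (j : ℤ) (s : ℝ) (hs : s = 1 ∨ s = -1) : Pv n j s ∈ prismPyramidVerts n := by
  have hn0 : (0:ℝ) < n := by positivity
  have hz : (0:ℤ) < 2 * n := by omega
  have h0 := Int.emod_nonneg j hz.ne'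
  have h1 := Int.emod_lt_of_pos j hz
  obtain ⟨r, hr⟩ : ∃ r : ℕ, j % (2 * n) = r := ⟨(j % (2 * n)).toNat, by omega⟩
  have hj : j = r + (2 * n) * (j / (2 * n)) := by rw [← hr]; exact (Int.emod_add_mul_ediv j _).symm
  have key : 2 * (j:ℝ) * th n = (r:ℝ) * π / n + ((j / (2 * n) : ℤ) : ℝ) * (2 * π) := by
    have : (j:ℝ) = r + (2 * n) * ((j / (2 * n) : ℤ) : ℝ) := by exact_mod_cast hj
    generalize (j / (2 * n) : ℤ) = q at *
    rw [this]; unfold th; field_simp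
  left
  refine ⟨⟨r, by omega⟩, ?_⟩
  have hP : Pv n j s = ![Real.cos (r * π / n), Real.sin (r * π / n), s] := by
    unfold Pv; rw [key, Real.cos_add_int_mul_two_pi, Real.sin_add_int_mul_two_pi]
  rw [hP]
  rcases hs with rfl | rfl
  · left; rfl
  · right; rfl

lemma verts_cases {n : ℕ} (hn : 3 ≤ n)
    {p : Fin 3 → ℝ} (hp : p ∈ prismPyramidVerts n) :
    (∃ (j : ℤ) (s : ℝ), (s = 1 ∨ s = -1) ∧ p = Pv n j s) ∨
    (∃ s : ℝ, (s = 1 ∨ s = -1) ∧ p = ![0, 0, 2 * s]) := by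
  have hn0 : (0:ℝ) < n := by positivity
  have key : ∀ j : ℕ, (j:ℝ) * π / n = 2 * ((j:ℤ):ℝ) * th n := by
    intro j; unfold th; push_cast; field_simp
  rcases hp with ⟨j, h | h⟩ | h | h
  · left; exact ⟨(j:ℕ), 1, Or.inl rfl, by rw [h, key, Pv]⟩
  · left; exact ⟨(j:ℕ), -1, Or.inr rfl, by rw [h, key, Pv]⟩
  · right; exact ⟨1, Or.inl rfl, by rw [h]; norm_num⟩
  · right; exact ⟨-1, Or.inr rfl, by rw [h]; norm_num⟩

lemma Fs_Pv_abs_le {n : ℕ} (hn : 3 ≤ n)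
    (k j : ℤ) (s : ℝ) : |Fs n ((2 * k + 1) * th n) (Pv n j s)| ≤ 1 := by
  rw [Fs_Pv, abs_div, abs_of_pos (cos_th_pos hn), div_le_one (cos_th_pos hn)]
  have := cos_odd hn (2 * (k - j) + 1) ⟨_, rfl⟩
  rwa [show ((2 * (k - j) + 1 : ℤ) : ℝ) * th n = (2 * k + 1) * th n - 2 * j * th n by
    push_cast; ring] at this

lemma Fs_le {n : ℕ} (hn : 3 ≤ n)
    (k : ℤ) : ∀ v ∈ prismPyramidVerts n, |Fs n ((2 * k + 1) * th n) v| ≤ 1 := by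
  intro v hv
  rcases verts_cases hn hv with ⟨j, s, hs, rfl⟩ | ⟨s, hs, rfl⟩
  · exact Fs_Pv_abs_le hn k j s
  · simp [Fs_apply]

lemma Gs_le {n : ℕ} (hn : 3 ≤ n)
    (k : ℤ) (s' : ℝ) (hs' : s' = 1 ∨ s' = -1) :
    ∀ v ∈ prismPyramidVerts n, |Gs n ((2 * k + 1) * th n) s' v| ≤ 1 := by
  intro v hv
  rcases verts_cases hn hv with ⟨j, s, hs, rfl⟩ | ⟨s, hs, rfl⟩
  · have h := Fs_Pv_abs_le hn k j s
    rw [abs_le] at h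
    have h2 : Pv n j s 2 = s := by simp [Pv]
    rw [Gs_apply, h2, abs_le]
    rcases hs with rfl | rfl <;> rcases hs' with rfl | rfl <;> constructor <;> linarith
  · rw [Gs_apply, Fs_apply]
    rcases hs with rfl | rfl <;> rcases hs' with rfl | rfl <;> simp

/-- every plane vector lies in one of the sectors -/
lemma sector {n : ℕ} (hn : 3 ≤ n)
    (a b : ℝ) : ∃ (k : ℤ) (p q : ℝ), 0 ≤ p ∧ 0 ≤ q ∧
    a = p * Real.cos (2 * k * th n) + q * Real.cos (2 * (k + 1 : ℤ) * th n) ∧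
    b = p * Real.sin (2 * k * th n) + q * Real.sin (2 * (k + 1 : ℤ) * th n) := by
  have ht := th_pos hn
  have ht6 := th_le hn
  have hpi := Real.pi_pos
  obtain ⟨ρ, φ, hρ, ha, hb⟩ : ∃ ρ φ : ℝ, 0 ≤ ρ ∧ a = ρ * Real.cos φ ∧ b = ρ * Real.sin φ := by
    refine ⟨‖(⟨a, b⟩ : ℂ)‖, Complex.arg ⟨a, b⟩, norm_nonneg _, ?_, ?_⟩
    · rw [Complex.norm_mul_cos_arg]
    · rw [Complex.norm_mul_sin_arg]
  set k := ⌊φ / (2 * th n)⌋ with hk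
  have h1 : (k:ℝ) ≤ φ / (2 * th n) := Int.floor_le _
  have h2 : φ / (2 * th n) < k + 1 := Int.lt_floor_add_one _
  rw [le_div_iff₀ (by positivity)] at h1
  rw [div_lt_iff₀ (by positivity)] at h2
  obtain ⟨τ, hτ⟩ : ∃ τ, τ = φ - 2 * k * th n := ⟨_, rfl⟩
  have hφ : φ = 2 * k * th n + τ := by rw [hτ]; ring
  have hτ0 : 0 ≤ τ := by linarith
  have hτ1 : τ ≤ 2 * th n := by linarith
  have hs : 0 < Real.sin (2 * th n) := Real.sin_pos_of_pos_of_lt_pi (by linarith) (by linarith)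
  refine ⟨k, ρ * Real.sin (2 * th n - τ) / Real.sin (2 * th n),
    ρ * Real.sin τ / Real.sin (2 * th n), ?_, ?_, ?_, ?_⟩
  · have := Real.sin_nonneg_of_nonneg_of_le_pi (x := 2 * th n - τ) (by linarith) (by linarith)
    positivity
  · have := Real.sin_nonneg_of_nonneg_of_le_pi (x := τ) (by linarith) (by linarith)
    positivity
  · rw [ha, hφ, show 2 * ((k + 1 : ℤ):ℝ) * th n = 2 * k * th n + 2 * th n by push_cast; ring]
    generalize 2 * (k:ℝ) * th n = x
    rw [Real.cos_add, Real.cos_add, Real.sin_sub]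
    field_simp
    ring
  · rw [hb, hφ, show 2 * ((k + 1 : ℤ):ℝ) * th n = 2 * k * th n + 2 * th n by push_cast; ring]
    generalize 2 * (k:ℝ) * th n = x
    rw [Real.sin_add, Real.sin_add, Real.sin_sub]
    field_simp
    ring



lemma vert_norm {X : Type*} [NormedAddCommGroup X] [NormedSpace ℝ X]
    {n : ℕ} (e : X ≃ₗ[ℝ] (Fin 3 → ℝ))
    (hball : closedBall (0 : X) 1 = e ⁻¹' (convexHull ℝ (prismPyramidVerts n)))
    {v : Fin 3 → ℝ} (hv : v ∈ prismPyramidVerts n) : ‖e.symm v‖ ≤ 1 := by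
  have : e.symm v ∈ closedBall (0:X) 1 := by
    rw [hball]; simpa using subset_convexHull ℝ _ hv
  simpa using this

lemma conv_bound {X : Type*} [NormedAddCommGroup X] [NormedSpace ℝ X]
    {n : ℕ} (e : X ≃ₗ[ℝ] (Fin 3 → ℝ))
    (hball : closedBall (0 : X) 1 = e ⁻¹' (convexHull ℝ (prismPyramidVerts n)))
    {Y : Type*} [NormedAddCommGroup Y] [NormedSpace ℝ Y] (L : X →ₗ[ℝ] Y) {C : ℝ}
    (hL : ∀ v ∈ prismPyramidVerts n, ‖L (e.symm v)‖ ≤ C) (x : X) : ‖L x‖ ≤ C * ‖x‖ := by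
  rcases eq_or_ne x 0 with rfl | hx
  · simp
  have hx0 : 0 < ‖x‖ := norm_pos_iff.mpr hx
  have hsub : convexHull ℝ (prismPyramidVerts n) ⊆
      (L ∘ₗ e.symm.toLinearMap) ⁻¹' closedBall (0:Y) C := by
    apply convexHull_min
    · intro v hv; simpa using hL v hv
    · exact (convex_closedBall _ _).linear_preimage _
  have h1 : ‖x‖⁻¹ • x ∈ closedBall (0:X) 1 := by
    simp [norm_smul, hx0.ne']
  rw [hball] at h1
  have h2 := hsub h1
  simp [norm_smul] at h2
  rwa [inv_mul_le_iff₀ hx0, mul_comm] at h2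

lemma func_bound {X : Type*} [NormedAddCommGroup X] [NormedSpace ℝ X]
    {n : ℕ} (e : X ≃ₗ[ℝ] (Fin 3 → ℝ))
    (hball : closedBall (0 : X) 1 = e ⁻¹' (convexHull ℝ (prismPyramidVerts n)))
    (g : (Fin 3 → ℝ) →ₗ[ℝ] ℝ) (hg : ∀ v ∈ prismPyramidVerts n, |g v| ≤ 1) (x : X) :
    |g (e x)| ≤ ‖x‖ := by
  have := conv_bound e hball (g ∘ₗ e.toLinearMap) (C := 1) (by
    intro v hv; simpa using hg v hv) x
  simpa using this

lemma nrad_bdd {X : Type*} [NormedAddCommGroup X] [NormedSpace ℝ X]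
    (T : X →L[ℝ] X) : BddAbove
    {r : ℝ | ∃ x : X, ∃ f : X →L[ℝ] ℝ, ‖x‖ = 1 ∧ ‖f‖ = 1 ∧ f x = 1 ∧ r = |f (T x)|} := by
  refine ⟨‖T‖, ?_⟩
  rintro r ⟨x, f, hx, hf, -, rfl⟩
  have h1 := f.le_opNorm (T x)
  have h2 := T.le_opNorm x
  rw [hf, one_mul, Real.norm_eq_abs] at h1
  rw [hx, mul_one] at h2
  linarith

lemma incident {X : Type*} [NormedAddCommGroup X] [NormedSpace ℝ X]
    {n : ℕ} (e : X ≃ₗ[ℝ] (Fin 3 → ℝ))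
    (hball : closedBall (0 : X) 1 = e ⁻¹' (convexHull ℝ (prismPyramidVerts n)))
    (T : X →L[ℝ] X) (g : (Fin 3 → ℝ) →ₗ[ℝ] ℝ)
    (hg : ∀ v ∈ prismPyramidVerts n, |g v| ≤ 1) {v : Fin 3 → ℝ} (hv : v ∈ prismPyramidVerts n)
    (hgv : g v = 1) : |g (e (T (e.symm v)))| ≤ nrad T := by
  have hfd : FiniteDimensional ℝ X := e.symm.finiteDimensional
  have hb := func_bound e hball g hg
  set f : X →L[ℝ] ℝ := LinearMap.toContinuousLinearMap (g ∘ₗ e.toLinearMap) with hf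
  have hfa : ∀ x, f x = g (e x) := fun x => rfl
  have hx : ‖e.symm v‖ = 1 := by
    apply le_antisymm (vert_norm e hball hv)
    have := hb (e.symm v)
    simpa [hgv] using this
  have hfx : f (e.symm v) = 1 := by rw [hfa]; simpa using hgv
  have hfn : ‖f‖ = 1 := by
    apply le_antisymm
    · apply f.opNorm_le_bound zero_le_one
      intro x; rw [hfa, one_mul]; exact hb x
    · have := f.le_opNorm (e.symm v)
      rw [hfx, hx] at this
      simpa using this
  exact le_csSup (nrad_bdd T) ⟨e.symm v, f, hx, hfn, hfx, rfl⟩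


/-- The half-space description of the ball. -/
lemma norm_le_of {X : Type*} [NormedAddCommGroup X] [NormedSpace ℝ X]
    {n : ℕ} (hn : 3 ≤ n) (e : X ≃ₗ[ℝ] (Fin 3 → ℝ))
    (hball : closedBall (0 : X) 1 = e ⁻¹' (convexHull ℝ (prismPyramidVerts n)))
    {y : Fin 3 → ℝ} {C : ℝ} (h1 : ∀ k : ℤ, |Fs n ((2 * k + 1) * th n) y| ≤ C)
    (h2 : ∀ k : ℤ, |Fs n ((2 * k + 1) * th n) y| + |y 2| ≤ 2 * C) : ‖e.symm y‖ ≤ C := by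
  obtain ⟨k, p, q, hp, hq, hy0, hy1⟩ := sector hn (y 0) (y 1)
  have hc := cos_th_pos hn
  have hF : Fs n ((2 * k + 1) * th n) y = p + q := by
    rw [Fs_apply, hy0, hy1, div_eq_iff hc.ne']
    rw [show (2 * (k:ℝ) + 1) * th n = 2 * k * th n + th n by ring,
      show 2 * ((k + 1 : ℤ):ℝ) * th n = (2 * k * th n + th n) + th n by push_cast; ring]
    have e1 : Real.cos (th n) = Real.cos ((2 * k * th n + th n) - 2 * k * th n) := by
      congr 1; ring
    have e2 : Real.cos (th n) =
        Real.cos ((2 * k * th n + th n) + th n - (2 * k * th n + th n)) := by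
      congr 1; ring
    rw [Real.cos_sub] at e1 e2
    linear_combination -p * e1 - q * e2
  have g1 := h1 k
  have g2 := h2 k
  rw [hF, abs_of_nonneg (by positivity)] at g1 g2
  set z := y 2 with hz
  obtain ⟨σ, hσ1, hσ2, hσ⟩ : ∃ σ : ℝ, -1 ≤ σ ∧ σ ≤ 1 ∧ |z - (p + q) * σ| ≤ 2 * (C - (p + q)) := by
    rcases le_or_gt z (p + q) with hz1 | hz1
    · rcases le_or_gt (-(p + q)) z with hz2 | hz2
      · rcases eq_or_lt_of_le (add_nonneg hp hq) with h0 | h0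
        · refine ⟨0, by norm_num, by norm_num, ?_⟩
          rw [← h0] at hz1 hz2 ⊢
          have : z = 0 := by linarith
          rw [this]; simp; linarith
        · refine ⟨z / (p + q), ?_, ?_, ?_⟩
          · rw [le_div_iff₀ h0]; linarith
          · rw [div_le_one h0]; exact hz1
          · rw [mul_div_cancel₀ _ h0.ne']; simp; linarith
      · refine ⟨-1, by norm_num, by norm_num, ?_⟩
        rw [abs_of_neg (by linarith : z < 0)] at g2
        rw [abs_le]; constructor <;> linarith
    · refine ⟨1, by norm_num, by norm_num, ?_⟩
      rw [abs_of_pos (by linarith : 0 < z)] at g2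
      rw [abs_le]; constructor <;> linarith
  have hP : ∀ j : ℤ, ‖e.symm (Pv n j σ)‖ ≤ 1 := by
    intro j
    have hd : Pv n j σ = ((1 + σ) / 2) • Pv n j 1 + ((1 - σ) / 2) • Pv n j (-1) := by
      ext i; fin_cases i <;> simp [Pv] <;> ring
    rw [hd, map_add, map_smul, map_smul]
    have a1 := vert_norm e hball (Pv_mem hn j 1 (Or.inl rfl))
    have a2 := vert_norm e hball (Pv_mem hn j (-1) (Or.inr rfl))
    refine (norm_add_le _ _).trans ?_
    rw [norm_smul, norm_smul, Real.norm_of_nonneg (by linarith), Real.norm_of_nonneg (by linarith)]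
    nlinarith
  have hA : ‖e.symm ![0, 0, 2]‖ ≤ 1 := vert_norm e hball (Or.inr (Or.inl rfl))
  have hd : y = p • Pv n k σ + q • Pv n (k + 1) σ +
      ((z - (p + q) * σ) / 2) • ![0, 0, 2] := by
    ext i; fin_cases i
    · simpa [Pv] using hy0
    · simpa [Pv] using hy1
    · simp [Pv, hz]; ring
  rw [hd, map_add, map_add, map_smul, map_smul, map_smul]
  refine (norm_add₃_le).trans ?_
  rw [norm_smul, norm_smul, norm_smul, Real.norm_of_nonneg hp, Real.norm_of_nonneg hq,
    Real.norm_eq_abs, abs_div, abs_two]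
  have b1 := hP k
  have b2 := hP (k + 1)
  have b3 : |z - (p + q) * σ| / 2 * ‖e.symm ![0, 0, 2]‖ ≤ |z - (p + q) * σ| / 2 :=
    mul_le_of_le_one_right (by positivity) hA
  nlinarith


/-! ### lower bound -/


/-- interpolation of side functionals -/
lemma Fs_interp {n : ℕ} (hn : 3 ≤ n)
    (φ ψ : ℝ) (y : Fin 3 → ℝ) :
    Fs n (φ + ψ) y = (Real.sin (ψ + th n) / Real.sin (2 * th n)) * Fs n (φ + th n) y +
      (-Real.sin (ψ - th n) / Real.sin (2 * th n)) * Fs n (φ - th n) y := by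
  have hc := cos_th_pos hn
  have hs := sin_th_pos hn
  have h2 : Real.sin (2 * th n) ≠ 0 := by rw [Real.sin_two_mul]; positivity
  simp only [Fs_apply, Real.cos_add, Real.sin_add, Real.cos_sub, Real.sin_sub]
  rw [div_mul_div_comm, div_mul_div_comm, ← add_div, div_eq_div_iff hc.ne' (by positivity)]
  rw [Real.sin_two_mul]
  ring

lemma trig_main {n : ℕ} (hn : 3 ≤ n)
    {K r α β w ψ : ℝ} (hK2 : 2 ≤ K) (hKm : |Real.sin ψ| ≤ K * Real.sin (th n))
    (hodd : Real.sin (th n) ≤ |Real.sin ψ|)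
    (hp : Real.sin (ψ + th n) = 0 ∨ Real.sin (2 * th n) ≤ |Real.sin (ψ + th n)|)
    (hq : Real.sin (ψ - th n) = 0 ∨ Real.sin (2 * th n) ≤ |Real.sin (ψ - th n)|)
    (c1 : |α| ≤ r) (c2 : |β| ≤ r) (c3 : |α + w| ≤ 2 * r) (c4 : |β + w| ≤ 2 * r) :
    |(Real.sin (ψ + th n) / Real.sin (2 * th n)) * α +
      (-Real.sin (ψ - th n) / Real.sin (2 * th n)) * β| ≤ K * r ∧
    |(Real.sin (ψ + th n) / Real.sin (2 * th n)) * α +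
      (-Real.sin (ψ - th n) / Real.sin (2 * th n)) * β| + |w| ≤ 2 * (K * r) := by
  have hc := cos_th_pos hn
  have hs := sin_th_pos hn
  have hr : 0 ≤ r := (abs_nonneg _).trans c1
  have hKr : 2 * r ≤ K * r := by gcongr
  obtain ⟨S2, hS2⟩ : ∃ S2, S2 = Real.sin (2 * th n) := ⟨_, rfl⟩
  have hS2' : S2 = 2 * Real.sin (th n) * Real.cos (th n) := by rw [hS2, Real.sin_two_mul]
  have hs2 : 0 < S2 := by rw [hS2']; positivity
  rw [← hS2] at hp hq ⊢
  obtain ⟨l, hl⟩ : ∃ l, l = Real.sin (ψ + th n) / S2 := ⟨_, rfl⟩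
  obtain ⟨u, hu⟩ : ∃ u, u = -Real.sin (ψ - th n) / S2 := ⟨_, rfl⟩
  rw [← hl, ← hu]
  have hlu : l * u ≤ 0 := by
    have : l * u = -((Real.sin ψ ^ 2 - Real.sin (th n) ^ 2) / S2 ^ 2) := by
      rw [hl, hu, Real.sin_add, Real.sin_sub]
      have q1 := Real.sin_sq_add_cos_sq ψ
      have q2 := Real.sin_sq_add_cos_sq (th n)
      field_simp
      linear_combination Real.sin (th n) ^ 2 * q1 - Real.sin ψ ^ 2 * q2
    rw [this]
    have : Real.sin (th n) ^ 2 ≤ Real.sin ψ ^ 2 := by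
      rw [← sq_abs (Real.sin ψ)]; gcongr
    have : 0 ≤ (Real.sin ψ ^ 2 - Real.sin (th n) ^ 2) / S2 ^ 2 :=
      div_nonneg (by linarith) (by positivity)
    linarith
  have hsum : |l| + |u| = |Real.sin ψ| / Real.sin (th n) := by
    have h1 : |l| + |u| = |l - u| := by
      rcases abs_cases l with ⟨e1, _⟩ | ⟨e1, _⟩ <;>
      rcases abs_cases u with ⟨e2, _⟩ | ⟨e2, _⟩ <;>
      rcases abs_cases (l - u) with ⟨e3, _⟩ | ⟨e3, _⟩ <;> rw [e1, e2, e3] <;> nlinarith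
    have h2 : l - u = Real.sin ψ / Real.sin (th n) := by
      rw [hl, hu, Real.sin_add, Real.sin_sub]
      rw [hS2']; field_simp; ring
    rw [h1, h2, abs_div, abs_of_pos hs]
  have hKlu : |l| + |u| ≤ K := by
    rw [hsum, div_le_iff₀ hs]; exact hKm
  refine ⟨two_bound c1 c2 hKlu, ?_⟩
  have hl2 : |l| = |Real.sin (ψ + th n)| / S2 := by rw [hl, abs_div, abs_of_pos hs2]
  have hu2 : |u| = |Real.sin (ψ - th n)| / S2 := by rw [hu, abs_div, abs_neg, abs_of_pos hs2]
  have hw : |w| ≤ 3 * r := by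
    rw [abs_le] at c1 c3 ⊢
    constructor <;> linarith
  have hadj : |Real.sin ψ| = Real.sin (th n) → |l * α + u * β| + |w| ≤ 2 * (K * r) := by
    intro h
    have h1 : |l| + |u| ≤ 1 := by rw [hsum, h, div_self hs.ne']
    have := two_bound c1 c2 h1
    nlinarith
  have hz : ∀ x : ℝ, Real.cos (th n) * Real.sin ψ = x * (Real.cos ψ * Real.sin (th n)) →
      x ^ 2 = 1 → |Real.sin ψ| = Real.sin (th n) := by
    intro x hx hx2
    have q1 := Real.sin_sq_add_cos_sq ψ
    have q2 := Real.sin_sq_add_cos_sq (th n)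
    have q3 : (Real.cos (th n) * Real.sin ψ) ^ 2 = (Real.cos ψ * Real.sin (th n)) ^ 2 := by
      rw [hx, mul_pow, hx2, one_mul]
    have : Real.sin ψ ^ 2 = Real.sin (th n) ^ 2 := by
      linear_combination q3 - Real.sin ψ ^ 2 * q2 + Real.sin (th n) ^ 2 * q1
    rw [← abs_of_pos hs]; exact (sq_eq_sq_iff_abs_eq_abs _ _).mp this
  rcases hp with hp | hp
  · apply hadj
    rw [Real.sin_add] at hp
    exact hz (-1) (by linarith) (by norm_num)
  rcases hq with hq | hq
  · apply hadj
    rw [Real.sin_sub] at hq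
    exact hz 1 (by linarith) (by norm_num)
  have := top_bound c1 c2 c3 c4 (by rw [hl2, le_div_iff₀ hs2, one_mul]; exact hp)
    (by rw [hu2, le_div_iff₀ hs2, one_mul]; exact hq) hlu hKlu
  nlinarith

lemma vert_bound {X : Type*} [NormedAddCommGroup X] [NormedSpace ℝ X]
    {n : ℕ} (hn : 3 ≤ n) (e : X ≃ₗ[ℝ] (Fin 3 → ℝ))
    (hball : closedBall (0 : X) 1 = e ⁻¹' (convexHull ℝ (prismPyramidVerts n)))
    (T : X →L[ℝ] X) {K : ℝ} (hK2 : 2 ≤ K)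
    (hK : ∀ m : ℤ, Odd m → |Real.sin (m * th n)| ≤ K * Real.sin (th n))
    {v : Fin 3 → ℝ} (hv : v ∈ prismPyramidVerts n) : ‖T (e.symm v)‖ ≤ K * nrad T := by
  have hc := cos_th_pos hn
  have hs := sin_th_pos hn
  have hs2 : 0 < Real.sin (2 * th n) := by rw [Real.sin_two_mul]; positivity
  have hv' := hv
  rcases verts_cases hn hv with ⟨j, s, hs1, rfl⟩ | ⟨s, hs1, rfl⟩
  · set y := e (T (e.symm (Pv n j s))) with hy
    have hys : T (e.symm (Pv n j s)) = e.symm y := by simp [hy]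
    rw [hys]
    have hss : s * s = 1 := by rcases hs1 with rfl | rfl <;> norm_num
    have hsa : |y 2| = |s * y 2| := by rcases hs1 with rfl | rfl <;> simp
    have hP2 : Pv n j s 2 = s := by simp [Pv]
    have ang1 : (2 * (j:ℝ) + 1) * th n = 2 * j * th n + th n := by ring
    have ang2 : (2 * ((j - 1 : ℤ):ℝ) + 1) * th n = 2 * j * th n - th n := by push_cast; ring
    have v1 : Fs n (2 * j * th n + th n) (Pv n j s) = 1 := by
      rw [Fs_Pv, add_sub_cancel_left, div_self hc.ne']
    have v2 : Fs n (2 * j * th n - th n) (Pv n j s) = 1 := by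
      rw [Fs_Pv, sub_sub_cancel_left, Real.cos_neg, div_self hc.ne']
    have c1 := incident e hball T _ (Fs_le hn j) hv (by rw [ang1, v1])
    have c2 := incident e hball T _ (Fs_le hn (j - 1)) hv (by rw [ang2, v2])
    have c3 := incident e hball T _ (Gs_le hn j s hs1) hv (by
      rw [ang1, Gs_apply, v1, hP2, hss]; norm_num)
    have c4 := incident e hball T _ (Gs_le hn (j - 1) s hs1) hv (by
      rw [ang2, Gs_apply, v2, hP2, hss]; norm_num)
    rw [← hy, ang1] at c1 c3
    rw [← hy, ang2] at c2 c4
    rw [Gs_apply, abs_div, abs_two, div_le_iff₀ two_pos, mul_comm (nrad T)] at c3 c4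
    set α := Fs n (2 * j * th n + th n) y
    set β := Fs n (2 * j * th n - th n) y
    set w := s * y 2
    set r := nrad T
    have hr : 0 ≤ r := (abs_nonneg _).trans c1
    have main : ∀ k : ℤ, |Fs n ((2 * k + 1) * th n) y| ≤ K * r ∧
        |Fs n ((2 * k + 1) * th n) y| + |w| ≤ 2 * (K * r) := by
      intro k
      obtain ⟨m, hm⟩ : ∃ m : ℤ, m = 2 * (k - j) + 1 := ⟨_, rfl⟩
      have hmo : Odd m := ⟨_, hm⟩
      have hk : (2 * (k:ℝ) + 1) * th n = 2 * j * th n + m * th n := by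
        rw [hm]; push_cast; ring
      have hKm := hK m hmo
      have hodd := sin_odd hn m hmo
      have hp := sin_even hn (k - j + 1)
      have hq := sin_even hn (k - j)
      have ap : 2 * ((k - j + 1 : ℤ):ℝ) * th n = m * th n + th n := by
        rw [hm]; push_cast; ring
      have aq : 2 * ((k - j : ℤ):ℝ) * th n = m * th n - th n := by
        rw [hm]; push_cast; ring
      rw [ap] at hp
      rw [aq] at hq
      rw [hk, Fs_interp hn]
      exact trig_main hn hK2 hKm hodd hp hq c1 c2 c3 c4
    apply norm_le_of hn e hball
    · intro k; exact (main k).1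
    · intro k; rw [hsa]; exact (main k).2
  · set y := e (T (e.symm ![0, 0, 2 * s])) with hy
    have hys : T (e.symm ![0, 0, 2 * s]) = e.symm y := by simp [hy]
    rw [hys]
    have hsa : |y 2| = |s * y 2| := by rcases hs1 with rfl | rfl <;> simp
    have hss : s * s = 1 := by rcases hs1 with rfl | rfl <;> norm_num
    have key : ∀ k : ℤ, |Fs n ((2 * k + 1) * th n) y + s * y 2| ≤ 2 * nrad T := by
      intro k
      have c := incident e hball T _ (Gs_le hn k s hs1) hv (by
        rw [Gs_apply, Fs_apply]; simp; linarith)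
      rw [← hy, Gs_apply, abs_div, abs_two, div_le_iff₀ two_pos, mul_comm (nrad T)] at c
      exact c
    have hr : 0 ≤ nrad T := by
      have := (abs_nonneg _).trans (key 0)
      linarith
    have key2 : ∀ k : ℤ, |Fs n ((2 * k + 1) * th n) y| + |y 2| ≤ 2 * nrad T := by
      intro k
      have k1 := key k
      have k2 := key (k + n)
      have : Fs n ((2 * ((k + n : ℤ):ℝ) + 1) * th n) y = - Fs n ((2 * k + 1) * th n) y := by
        have ha : (2 * ((k + n : ℤ):ℝ) + 1) * th n = (2 * k + 1) * th n + π := by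
          push_cast; linear_combination 2 * n_th hn
        rw [ha, Fs_apply, Fs_apply, Real.cos_add_pi, Real.sin_add_pi]; ring
      rw [this] at k2
      rw [hsa]
      rw [abs_le] at k1 k2
      rcases abs_cases (Fs n ((2 * k + 1) * th n) y) with ⟨e1, _⟩ | ⟨e1, _⟩ <;>
      rcases abs_cases (s * y 2) with ⟨e2, _⟩ | ⟨e2, _⟩ <;> rw [e1, e2] <;> linarith
    have hK3 : 2 * nrad T ≤ K * nrad T := by gcongr
    apply norm_le_of hn e hball
    · intro k
      have := key2 k
      have := abs_nonneg (y 2)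
      linarith
    · intro k
      have := key2 k
      linarith

lemma lower_bound {X : Type*} [NormedAddCommGroup X] [NormedSpace ℝ X]
    {n : ℕ} (hn : 3 ≤ n) (e : X ≃ₗ[ℝ] (Fin 3 → ℝ))
    (hball : closedBall (0 : X) 1 = e ⁻¹' (convexHull ℝ (prismPyramidVerts n)))
    (T : X →L[ℝ] X) (hT : ‖T‖ = 1) {t : ℝ} (ht0 : 0 < t) (ht2 : t ≤ 1 / 2)
    (ht : ∀ m : ℤ, Odd m → t * |Real.sin (m * th n)| ≤ Real.sin (th n)) : t ≤ nrad T := by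
  have h := conv_bound e hball T.toLinearMap (C := t⁻¹ * nrad T) (by
    intro v hv
    refine vert_bound hn e hball T ?_ ?_ hv
    · rw [le_inv_comm₀ two_pos ht0]; linarith
    · intro m hm
      rw [le_inv_mul_iff₀ ht0]; exact ht m hm)
  have hr : 0 ≤ nrad T := by
    apply Real.sSup_nonneg
    rintro r ⟨x, f, -, -, -, rfl⟩
    exact abs_nonneg _
  have := T.opNorm_le_bound (by positivity) h
  rw [hT, le_inv_mul_iff₀ ht0] at this
  linarith

/-! ### upper bound -/

lemma rot_bound {n : ℕ} (hn : 3 ≤ n)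
    (v : Fin 3 → ℝ) (hv : v ∈ prismPyramidVerts n) (s : ℝ) (hs : s = 1 ∨ s = -1)
    (k : ℤ) : |Fs n ((2 * k + 1) * th n)
      (v + (s * Real.tan (th n)) • ![-(v 1), v 0, 0])| ≤ 1 + Real.tan (th n) ^ 2 := by
  have hc := cos_th_pos hn
  have ht : 1 + Real.tan (th n) ^ 2 = 1 / Real.cos (th n) ^ 2 := by
    rw [← Real.inv_one_add_tan_sq hc.ne']; simp
  rcases verts_cases hn hv with ⟨j, s', hs', rfl⟩ | ⟨s', hs', rfl⟩
  · have : Fs n ((2 * k + 1) * th n)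
        (Pv n j s' + (s * Real.tan (th n)) • ![-(Pv n j s' 1), Pv n j s' 0, 0]) =
        Real.cos ((2 * k + 1) * th n - 2 * j * th n - s * th n) / Real.cos (th n) ^ 2 := by
      rw [Fs_apply]
      have h1 : Real.cos (s * th n) = Real.cos (th n) := by
        rcases hs with rfl | rfl <;> simp
      have h2 : Real.sin (s * th n) = s * Real.sin (th n) := by
        rcases hs with rfl | rfl <;> simp
      rw [Real.cos_sub, h1, h2, Real.cos_sub, Real.sin_sub, Real.tan_eq_sin_div_cos]
      simp [Pv]
      field_simp
      ring
    rw [this, ht, abs_div, abs_of_pos (by positivity : 0 < Real.cos (th n) ^ 2)]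
    gcongr
    exact Real.abs_cos_le_one _
  · rw [Fs_apply]; simp
    positivity

lemma upper_bound {X : Type*} [NormedAddCommGroup X] [NormedSpace ℝ X]
    {n : ℕ} (hn : 3 ≤ n) (e : X ≃ₗ[ℝ] (Fin 3 → ℝ))
    (hball : closedBall (0 : X) 1 = e ⁻¹' (convexHull ℝ (prismPyramidVerts n)))
    {c : ℝ} (hc0 : 0 < c) (k : ℤ)
    (hk : c ≤ Real.sin ((2 * k + 1) * th n) / Real.cos (th n)) :
    nindex X ≤ Real.tan (th n) / c := by
  have hfd : FiniteDimensional ℝ X := e.symm.finiteDimensional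
  have hc := cos_th_pos hn
  have hs := sin_th_pos hn
  have htan : 0 < Real.tan (th n) := by rw [Real.tan_eq_sin_div_cos]; positivity
  set ρ : (Fin 3 → ℝ) →ₗ[ℝ] (Fin 3 → ℝ) :=
    LinearMap.pi ![lf 0 (-1) 0, lf 1 0 0, lf 0 0 0] with hρ
  have hρa : ∀ y, ρ y = ![-(y 1), y 0, 0] := by
    intro y; ext i; fin_cases i <;> simp [hρ, lf_apply]
  set T : X →L[ℝ] X := LinearMap.toContinuousLinearMap
    (e.symm.toLinearMap ∘ₗ ρ ∘ₗ e.toLinearMap) with hT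
  have hTa : ∀ x, T x = e.symm (ρ (e x)) := fun x => rfl
  -- norm from below
  have hTn : c ≤ ‖T‖ := by
    have hv := Pv_mem hn 0 1 (Or.inl rfl)
    have h1 := vert_norm e hball hv
    have h2 := func_bound e hball _ (Fs_le hn k) (T (e.symm (Pv n 0 1)))
    have h3 := T.le_opNorm (e.symm (Pv n 0 1))
    rw [hTa] at h2
    simp [hρa, Fs_apply, Pv] at h2
    have h4 : ‖T‖ * ‖e.symm (Pv n 0 1)‖ ≤ ‖T‖ := mul_le_of_le_one_right (norm_nonneg _) h1
    have h5 := le_abs_self (Real.sin ((2 * k + 1) * th n) / Real.cos (th n))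
    rw [hTa] at h3
    simp [hρa, Pv] at h3 h4
    linarith
  have hT0 : 0 < ‖T‖ := hc0.trans_le hTn
  -- perturbation
  have hpert : ∀ s : ℝ, (s = 1 ∨ s = -1) → ∀ x : X,
      ‖x + (s * Real.tan (th n)) • T x‖ ≤ (1 + Real.tan (th n) ^ 2) * ‖x‖ := by
    intro s hs1 x
    have := conv_bound e hball
      (LinearMap.id + (s * Real.tan (th n)) • T.toLinearMap) (C := 1 + Real.tan (th n) ^ 2) (by
      intro v hv
      have he : (LinearMap.id + (s * Real.tan (th n)) • T.toLinearMap : X →ₗ[ℝ] X) (e.symm v) =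
          e.symm (v + (s * Real.tan (th n)) • ![-(v 1), v 0, 0]) := by
        rw [map_add, map_smul, ← hρa]
        simp [hTa]
      rw [he]
      rcases verts_cases hn hv with ⟨j, s', hs', rfl⟩ | ⟨s', hs', rfl⟩
      · have hb := rot_bound hn _ hv s hs1
        apply norm_le_of hn e hball hb
        intro k
        have h1 := hb k
        have h2 : |(Pv n j s' + (s * Real.tan (th n)) • ![-(Pv n j s' 1), Pv n j s' 0, 0]) 2| = 1 := by
          rcases hs' with rfl | rfl <;> simp [Pv]
        rw [h2]
        nlinarith [sq_nonneg (Real.tan (th n))]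
      · have h1 := vert_norm e hball hv
        have h2 : (![0, 0, 2 * s'] + (s * Real.tan (th n)) •
            ![-((![0, 0, 2 * s'] : Fin 3 → ℝ) 1), (![0, 0, 2 * s'] : Fin 3 → ℝ) 0, 0]) =
            (![0, 0, 2 * s'] : Fin 3 → ℝ) := by
          ext i; fin_cases i <;> simp
        rw [h2]
        nlinarith [sq_nonneg (Real.tan (th n))]) x
    simpa using this
  have hnum : ∀ x : X, ∀ f : X →L[ℝ] ℝ, ‖x‖ = 1 → ‖f‖ = 1 → f x = 1 →
      |f (T x)| ≤ Real.tan (th n) := by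
    intro x f hx hf hfx
    have hs' : ∀ s : ℝ, (s = 1 ∨ s = -1) → s * f (T x) ≤ Real.tan (th n) := by
      intro s hs1
      have h1 := hpert s hs1 x
      have h2 := f.le_opNorm (x + (s * Real.tan (th n)) • T x)
      have h3 := le_abs_self (f (x + (s * Real.tan (th n)) • T x))
      rw [hf, one_mul, Real.norm_eq_abs] at h2
      rw [hx, mul_one] at h1
      have h4 := (h3.trans h2).trans h1
      rw [map_add, map_smul, hfx, smul_eq_mul] at h4
      have h5 : Real.tan (th n) * (s * f (T x)) ≤ Real.tan (th n) * Real.tan (th n) := by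
        nlinarith
      exact le_of_mul_le_mul_left h5 htan
    have a1 := hs' 1 (Or.inl rfl)
    have a2 := hs' (-1) (Or.inr rfl)
    rw [abs_le]; constructor <;> linarith
  have hle : nrad (‖T‖⁻¹ • T) ≤ Real.tan (th n) / c := by
    apply Real.sSup_le _ (by positivity)
    rintro r ⟨x, f, hx, hf, hfx, rfl⟩
    have h1 := hnum x f hx hf hfx
    have h2 : |f ((‖T‖⁻¹ • T) x)| = |f (T x)| / ‖T‖ := by
      simp [abs_mul, div_eq_inv_mul]
    rw [h2]
    gcongr
  refine le_trans (csInf_le ?_ ?_) hle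
  · refine ⟨0, ?_⟩
    rintro r ⟨S, -, rfl⟩
    apply Real.sSup_nonneg
    rintro r ⟨x, f, -, -, -, rfl⟩
    exact abs_nonneg _
  · refine ⟨‖T‖⁻¹ • T, ?_, rfl⟩
    rw [norm_smul, norm_inv, norm_norm, inv_mul_cancel₀ hT0.ne']

lemma index_eq {X : Type*} [NormedAddCommGroup X] [NormedSpace ℝ X]
    {n : ℕ} (hn : 3 ≤ n) (e : X ≃ₗ[ℝ] (Fin 3 → ℝ))
    (hball : closedBall (0 : X) 1 = e ⁻¹' (convexHull ℝ (prismPyramidVerts n)))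
    {t : ℝ} (ht0 : 0 < t) (ht2 : t ≤ 1 / 2)
    (ht : ∀ m : ℤ, Odd m → t * |Real.sin (m * th n)| ≤ Real.sin (th n)) {c : ℝ} (hc0 : 0 < c)
    (k : ℤ) (hk : c ≤ Real.sin ((2 * k + 1) * th n) / Real.cos (th n))
    (hct : Real.tan (th n) / c = t) : nindex X = t := by
  apply le_antisymm
  · rw [← hct]; exact upper_bound hn e hball hc0 k hk
  · have hfd : FiniteDimensional ℝ X := e.symm.finiteDimensional
    have hne : Nontrivial X := e.toEquiv.nontrivial
    apply le_csInf
    · exact ⟨_, ContinuousLinearMap.id ℝ X, ContinuousLinearMap.norm_id, rfl⟩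
    · rintro r ⟨T, hT, rfl⟩
      exact lower_bound hn e hball T hT ht0 ht2 ht


theorem stmt_13 {X : Type*} [NormedAddCommGroup X] [NormedSpace ℝ X]
    (n : ℕ) (hn : 3 ≤ n)
    (e : X ≃ₗ[ℝ] (Fin 3 → ℝ))
    (hball : closedBall (0 : X) 1 = e ⁻¹' (convexHull ℝ (prismPyramidVerts n))) :
    (Odd n → nindex X = Real.sin (π / (2 * n))) ∧
    (Even n → nindex X = Real.tan (π / (2 * n))) := by
  have hth : π / (2 * n) = th n := rfl
  rw [hth]
  have hc := cos_th_pos hn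
  have hs := sin_th_pos hn
  constructor
  · rintro ⟨i, hi⟩
    refine index_eq hn e hball hs (sin_th_le hn) ?_ (c := 1 / Real.cos (th n)) (by positivity) i ?_ ?_
    · intro m _
      exact mul_le_of_le_one_right hs.le (Real.abs_sin_le_one _)
    · have : (2 * ((i:ℤ):ℝ) + 1) * th n = π / 2 := by
        rw [← n_th hn, hi]; push_cast; ring
      rw [this, Real.sin_pi_div_two]
    · rw [Real.tan_eq_sin_div_cos]; field_simp
  · intro he
    obtain ⟨i, hi⟩ := id he
    refine index_eq hn e hball (t := Real.tan (th n)) ?_ ?_ ?_ one_pos i ?_ (div_one _)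
    · rw [Real.tan_eq_sin_div_cos]; positivity
    · have hn4 : (4:ℝ) ≤ n := by
        have : 4 ≤ n := by omega
        exact_mod_cast this
      have h1 := n_th hn
      have h2 := th_pos hn
      have h3 : th n ≤ π / 8 := by nlinarith
      -- `2 sin θ ≤ cos θ` since `2 sin² θ ≤ 1 - √2/2`
      have h4 : Real.cos (π / 4) ≤ Real.cos (2 * th n) :=
        Real.cos_le_cos_of_nonneg_of_le_pi (by linarith) (by linarith [Real.pi_pos]) (by linarith)
      rw [Real.cos_pi_div_four, Real.cos_two_mul] at h4
      have h5 : (1.3:ℝ) ≤ √2 := by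
        apply Real.le_sqrt_of_sq_le; norm_num
      have h6 := Real.sin_sq_add_cos_sq (th n)
      rw [Real.tan_eq_sin_div_cos, div_le_iff₀ hc]
      nlinarith
    · intro m hm
      have h := sin_odd_le hn m hm he
      rw [Real.tan_eq_sin_div_cos, div_mul_eq_mul_div, div_le_iff₀ hc]
      gcongr
    · have : (2 * ((i:ℤ):ℝ) + 1) * th n = th n + π / 2 := by
        rw [← n_th hn, hi]; push_cast; ring
      rw [this, Real.sin_add_pi_div_two, div_self hc.ne']
end
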